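/- Let g ∈ S₀(ℝ), let α, β > 0 be such that (g, αℤ×βℤ) is a frame sequence with closed linear span 𝒢 = 𝒢(g, αℤ×βℤ) and canonical dual window γ, and let ν ∈ ℕ, ν ≥ 1. If T_{α/ν} g ∈ 𝒢, then ⟨T_{k/β} M_{ℓ/α} γ, g⟩ = 0 for all k ∈ ℤ and all ℓ ∈ ℤ with ℓ ∉ νℤ. -/

import Mathlib

open MeasureTheory Complex Filter
open scoped ENNReal InnerProductSpace RealInnerProductSpace ComplexConjugate

noncomputable section

/-- The Hilbert space `L²(ℝ)` of complex-valued square-integrable functions. -/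
abbrev L2 : Type := Lp ℂ 2 (volume : Measure ℝ)

lemma memLp_translate (a : ℝ) (f : L2) :
    MemLp (fun x : ℝ => f (x - a)) 2 (volume : Measure ℝ) :=
  (Lp.memLp f).comp_measurePreserving (measurePreserving_sub_right volume a)

lemma memLp_modulate (b : ℝ) (f : L2) :
    MemLp (fun x : ℝ => Complex.exp (2 * Real.pi * Complex.I * (b * x)) * f x) 2
      (volume : Measure ℝ) := by
  refine MemLp.of_le (Lp.memLp f) ?_ ?_
  · exact (Complex.continuous_exp.comp (by fun_prop)).aestronglyMeasurable.mul
      (Lp.aestronglyMeasurable f)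
  · filter_upwards with x
    have : Complex.exp (2 * Real.pi * Complex.I * (b * x))
        = Complex.exp ((2 * Real.pi * (b * x) : ℝ) * Complex.I) := by
      push_cast; ring_nf
    rw [norm_mul, this, Complex.norm_exp_ofReal_mul_I, one_mul]

/-- Translation `T_a` on `L²(ℝ)`: `(T_a f)(x) = f (x - a)`. -/
def Tr (a : ℝ) (f : L2) : L2 := (memLp_translate a f).toLp _

/-- Modulation `M_b` on `L²(ℝ)`: `(M_b f)(x) = e^{2πibx} f x`. -/
def Mo (b : ℝ) (f : L2) : L2 := (memLp_modulate b f).toLp _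

/-- Time-frequency shift `π(a,b) = T_a M_b`. -/
def tf (z : ℝ × ℝ) (f : L2) : L2 := Tr z.1 (Mo z.2 f)

/-- The closed linear span `𝒢(g,Λ)` of the Gabor system `(g,Λ)`. -/
def gaborSpan (g : L2) (Λ : Set (ℝ × ℝ)) : Set L2 :=
  closure (Submodule.span ℂ ((fun z => tf z g) '' Λ) : Set L2)

/-- `𝔍(𝒢)`: the set of time-frequency shifts leaving `𝒢` invariant. -/
def stab (G : Set L2) : Set (ℝ × ℝ) := {z | ∀ f ∈ G, tf z f ∈ G}

/-- `Λ` is a lattice in `ℝ²` if `Λ = Aℤ²` for an invertible `2×2` matrix `A`. -/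
def IsLattice (Λ : Set (ℝ × ℝ)) : Prop :=
  ∃ A : Matrix (Fin 2) (Fin 2) ℝ, IsUnit A.det ∧
    Λ = {p : ℝ × ℝ | ∃ k l : ℤ,
      p = (A 0 0 * k + A 0 1 * l, A 1 0 * k + A 1 1 * l)}

lemma memLp_gaussian : MemLp (fun x : ℝ => (Real.exp (-Real.pi * x ^ 2) : ℂ)) 2
    (volume : Measure ℝ) := by
  rw [memLp_two_iff_integrable_sq_norm]
  · have h : Integrable (fun x : ℝ => Real.exp (-(2 * Real.pi) * x ^ 2)) volume :=
      integrable_exp_neg_mul_sq (by positivity)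
    refine h.congr (Eventually.of_forall fun x => ?_)
    simp only [Complex.norm_real, Real.norm_eq_abs, Real.abs_exp, sq, ← Real.exp_add]
    ring_nf
  · exact (Complex.continuous_ofReal.comp (by fun_prop)).aestronglyMeasurable

/-- The Gaussian `φ(x) = e^{-πx²}` as an element of `L²(ℝ)`. -/
def gaussL2 : L2 := memLp_gaussian.toLp _

/-- The Feichtinger algebra condition: `f ∈ S₀(ℝ)` iff `(a,b) ↦ ⟨f, π(a,b)φ⟩ ∈ L¹(ℝ²)`. -/
def InS0 (f : L2) : Prop :=
  Integrable (fun z : ℝ × ℝ => ⟪tf z gaussL2, f⟫_ℂ) (volume : Measure (ℝ × ℝ))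

/-- `(g,Λ)` is a frame for its closed linear span. -/
def IsFrameSeq (g : L2) (Λ : Set (ℝ × ℝ)) : Prop :=
  ∃ A B : ℝ, 0 < A ∧ 0 < B ∧ ∀ f ∈ gaborSpan g Λ,
    A * ‖f‖ ^ 2 ≤ ∑' lam : Λ, ‖⟪tf (lam : ℝ × ℝ) g, f⟫_ℂ‖ ^ 2 ∧
    ∑' lam : Λ, ‖⟪tf (lam : ℝ × ℝ) g, f⟫_ℂ‖ ^ 2 ≤ B * ‖f‖ ^ 2

/-- `(g,Λ)` is a frame for all of `L²(ℝ)`. -/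
def IsFrameL2 (g : L2) (Λ : Set (ℝ × ℝ)) : Prop :=
  ∃ A B : ℝ, 0 < A ∧ 0 < B ∧ ∀ f : L2,
    A * ‖f‖ ^ 2 ≤ ∑' lam : Λ, ‖⟪tf (lam : ℝ × ℝ) g, f⟫_ℂ‖ ^ 2 ∧
    ∑' lam : Λ, ‖⟪tf (lam : ℝ × ℝ) g, f⟫_ℂ‖ ^ 2 ≤ B * ‖f‖ ^ 2

/-- Euclidean ball of radius `ε` around `a ∈ ℝ²`. -/
def eball (ε : ℝ) (a : ℝ × ℝ) : Set (ℝ × ℝ) :=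
  {x : ℝ × ℝ | Real.sqrt ((x.1 - a.1) ^ 2 + (x.2 - a.2) ^ 2) < ε}

/-- `B_ε(Δ) = ⋃_{a ∈ Δ} B_ε(a)`. -/
def eballSet (ε : ℝ) (Δ : Set (ℝ × ℝ)) : Set (ℝ × ℝ) := ⋃ a ∈ Δ, eball ε a

/-- The separable lattice `αℤ × βℤ`. -/
def sepLattice (α β : ℝ) : Set (ℝ × ℝ) :=
  {p : ℝ × ℝ | ∃ k l : ℤ, p = (α * k, β * l)}


/-- `γ` is the canonical dual window of the frame sequence `(g, αℤ×βℤ)`: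
`γ` belongs to `𝒢(g, αℤ×βℤ)` and `Sγ = g` for the frame operator `S`,
the defining series converging unconditionally in `L²`. -/
def IsDualWindow (g γ : L2) (α β : ℝ) : Prop :=
  γ ∈ gaborSpan g (sepLattice α β) ∧
  HasSum (fun lam : sepLattice α β =>
    ⟪tf (lam : ℝ × ℝ) g, γ⟫_ℂ • tf (lam : ℝ × ℝ) g) g

section FrameSequences

variable {H ι : Type*} [NormedAddCommGroup H] [InnerProductSpace ℂ H]

/-- The analysis operator of a Bessel family, as a bounded operator into `ℓ²`. -/
lemma exists_analysis_operator {v : ι → H} {B : ℝ}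
    (hv : ∀ (f : H) (s : Finset ι), ∑ i ∈ s, ‖⟪v i, f⟫_ℂ‖ ^ 2 ≤ B * ‖f‖ ^ 2) :
    ∃ C : H →L[ℂ] lp (fun _ : ι => ℂ) 2, ∀ f i, C f i = ⟪v i, f⟫_ℂ := by
  have hmem : ∀ f : H, Memℓp (fun i => ⟪v i, f⟫_ℂ) 2 := fun f =>
    memℓp_gen' (C := B * ‖f‖ ^ 2) fun s => by simpa using hv f s
  let L : H →ₗ[ℂ] lp (fun _ : ι => ℂ) 2 :=
    { toFun := fun f => ⟨fun i => ⟪v i, f⟫_ℂ, hmem f⟩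
      map_add' := fun f h => by ext i; exact inner_add_right _ _ _
      map_smul' := fun c f => by ext i; exact inner_smul_right _ _ _ }
  refine ⟨L.mkContinuous (√ B) fun f => ?_, fun f i => rfl⟩
  refine lp.norm_le_of_forall_sum_le (by norm_num) (by positivity) fun s => ?_
  have h := hv f s
  rcases le_or_gt 0 B with hB | hB
  · simpa [mul_pow, Real.sq_sqrt hB, L] using h
  · have h0 : ∑ i ∈ s, ‖⟪v i, f⟫_ℂ‖ ^ 2 ≤ 0 := h.trans (by nlinarith [sq_nonneg ‖f‖])
    simpa [Real.sqrt_eq_zero_of_nonpos hB.le, L] using h0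

/-- A Bessel bound on a subspace containing the family extends to the whole space. -/
lemma bessel_of_bessel_on {v : ι → H} {B : ℝ} (hB : 0 ≤ B) (K : Submodule ℂ H)
    [K.HasOrthogonalProjection] (hvK : ∀ i, v i ∈ K)
    (hv : ∀ f ∈ K, ∀ s : Finset ι, ∑ i ∈ s, ‖⟪v i, f⟫_ℂ‖ ^ 2 ≤ B * ‖f‖ ^ 2)
    (f : H) (s : Finset ι) : ∑ i ∈ s, ‖⟪v i, f⟫_ℂ‖ ^ 2 ≤ B * ‖f‖ ^ 2 := by
  have h := hv (K.starProjection f) (K.starProjection_apply_mem f) s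
  have hin : ∀ i, ⟪v i, K.starProjection f⟫_ℂ = ⟪v i, f⟫_ℂ := fun i => by
    rw [← K.inner_starProjection_left_eq_right, K.starProjection_eq_self_iff.2 (hvK i)]
  simp only [hin] at h
  refine h.trans ?_
  gcongr
  exact K.norm_starProjection_apply_le f

/-- Weak reconstruction: if `v` is a frame for its closed span `K` and `w` is its canonical dual,
then `⟪h, P_K f⟫ = ∑ ⟪w i, f⟫ ⟪h, v i⟫`. -/
lemma hasSum_inner_starProjection [CompleteSpace H] {v w : ι → H} {A B : ℝ}
    (hA : 0 < A) (hB : 0 < B)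
    (hlow : ∀ f ∈ (Submodule.span ℂ (Set.range v)).topologicalClosure,
      A * ‖f‖ ^ 2 ≤ ∑' i, ‖⟪v i, f⟫_ℂ‖ ^ 2)
    (hup : ∀ f ∈ (Submodule.span ℂ (Set.range v)).topologicalClosure,
      ∑' i, ‖⟪v i, f⟫_ℂ‖ ^ 2 ≤ B * ‖f‖ ^ 2)
    (hwK : ∀ i, w i ∈ (Submodule.span ℂ (Set.range v)).topologicalClosure)
    (hw : ∀ j, HasSum (fun i => ⟪v i, w j⟫_ℂ • v i) (v j)) (f h : H) :
    HasSum (fun i => ⟪w i, f⟫_ℂ * ⟪h, v i⟫_ℂ)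
      ⟪h, (Submodule.span ℂ (Set.range v)).topologicalClosure.starProjection f⟫_ℂ := by
  set K := (Submodule.span ℂ (Set.range v)).topologicalClosure with hK
  have hspan : Submodule.span ℂ (Set.range v) ≤ K := Submodule.le_topologicalClosure _
  have hvK : ∀ i, v i ∈ K := fun i => hspan (Submodule.subset_span ⟨i, rfl⟩)
  have hsummable : ∀ f ∈ K, Summable fun i => ‖⟪v i, f⟫_ℂ‖ ^ 2 := by
    intro f hf
    by_contra hns
    have h1 := hlow f hf
    rw [tsum_eq_zero_of_not_summable hns] at h1
    have h2 : ‖f‖ = 0 := by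
      by_contra hne
      have : 0 < ‖f‖ ^ 2 := by positivity
      nlinarith
    rw [norm_eq_zero.1 h2] at hns
    exact hns (by simp)
  have hbv : ∀ (f : H) (s : Finset ι), ∑ i ∈ s, ‖⟪v i, f⟫_ℂ‖ ^ 2 ≤ B * ‖f‖ ^ 2 :=
    bessel_of_bessel_on hB.le K hvK fun f hf s =>
      ((hsummable f hf).sum_le_tsum s fun _ _ => by positivity).trans (hup f hf)
  have hexp : ∀ j h, HasSum (fun i => ⟪v i, w j⟫_ℂ * ⟪h, v i⟫_ℂ) ⟪h, v j⟫_ℂ := fun j h => by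
    simpa [inner_smul_right] using (hw j).mapL (innerSL ℂ h)
  have hsymm : ∀ i j, ⟪w i, v j⟫_ℂ = ⟪v i, w j⟫_ℂ := by
    intro i j
    have h1 := hexp j (w i)
    have h2 := Complex.hasSum_conj'.2 (hexp i (w j))
    simp only [map_mul, inner_conj_symm] at h2
    exact h1.unique (h2.congr_fun fun k => mul_comm _ _)
  -- the frame operator maps the span of `w` onto the span of `v`
  have hlift : ∀ f ∈ Submodule.span ℂ (Set.range v), ∃ f' ∈ K,
      (∀ i, ⟪w i, f⟫_ℂ = ⟪v i, f'⟫_ℂ) ∧ HasSum (fun i => ⟪v i, f'⟫_ℂ • v i) f := by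
    intro f hf
    induction hf using Submodule.span_induction with
    | mem x hx =>
      obtain ⟨j, rfl⟩ := hx
      exact ⟨w j, hwK j, fun i => hsymm i j, hw j⟩
    | zero => exact ⟨0, K.zero_mem, by simp, by simp⟩
    | add x y _ _ ihx ihy =>
      obtain ⟨x', hx', hx1, hx2⟩ := ihx
      obtain ⟨y', hy', hy1, hy2⟩ := ihy
      refine ⟨x' + y', K.add_mem hx' hy', fun i => by simp [hx1, hy1], ?_⟩
      simpa [inner_add_right, add_smul] using hx2.add hy2
    | smul c x _ ih =>
      obtain ⟨x', hx', hx1, hx2⟩ := ih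
      refine ⟨c • x', K.smul_mem c hx', fun i => by simp [hx1], ?_⟩
      simpa [inner_smul_right, mul_smul] using hx2.const_smul c
  have hbw_span : ∀ f ∈ Submodule.span ℂ (Set.range v), ∀ s : Finset ι,
      ∑ i ∈ s, ‖⟪w i, f⟫_ℂ‖ ^ 2 ≤ B / A ^ 2 * ‖f‖ ^ 2 := by
    intro f hf s
    obtain ⟨f', hf', h1, h2⟩ := hlift f hf
    have h3 : HasSum (fun i => ((‖⟪v i, f'⟫_ℂ‖ ^ 2 : ℝ) : ℂ)) ⟪f', f⟫_ℂ := by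
      refine (h2.mapL (innerSL ℂ f')).congr_fun fun i => ?_
      rw [innerSL_apply_apply, inner_smul_right, ← inner_conj_symm f' (v i), Complex.mul_conj,
        Complex.normSq_eq_norm_sq]
    have h4 : A * ‖f'‖ ^ 2 ≤ ‖f'‖ * ‖f‖ := by
      refine (hlow f' hf').trans ?_
      have h5 : ((∑' i, ‖⟪v i, f'⟫_ℂ‖ ^ 2 : ℝ) : ℂ) = ⟪f', f⟫_ℂ := by
        rw [Complex.ofReal_tsum]; exact h3.tsum_eq
      calc ∑' i, ‖⟪v i, f'⟫_ℂ‖ ^ 2 ≤ ‖((∑' i, ‖⟪v i, f'⟫_ℂ‖ ^ 2 : ℝ) : ℂ)‖ := by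
            rw [Complex.norm_real]; exact le_abs_self _
        _ ≤ ‖f'‖ * ‖f‖ := by rw [h5]; exact norm_inner_le_norm _ _
    have h6 : ‖f'‖ ≤ ‖f‖ / A := by
      rw [le_div_iff₀ hA]
      rcases (norm_nonneg f').eq_or_lt with h0 | h0
      · rw [← h0]; simp
      · nlinarith
    calc ∑ i ∈ s, ‖⟪w i, f⟫_ℂ‖ ^ 2 = ∑ i ∈ s, ‖⟪v i, f'⟫_ℂ‖ ^ 2 := by simp only [h1]
      _ ≤ B * ‖f'‖ ^ 2 := hbv f' s
      _ ≤ B * (‖f‖ / A) ^ 2 := by gcongr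
      _ = B / A ^ 2 * ‖f‖ ^ 2 := by ring
  have hbw : ∀ (f : H) (s : Finset ι), ∑ i ∈ s, ‖⟪w i, f⟫_ℂ‖ ^ 2 ≤ B / A ^ 2 * ‖f‖ ^ 2 := by
    refine bessel_of_bessel_on (by positivity) K hwK fun f hf s => ?_
    have hcl : IsClosed {f : H | ∑ i ∈ s, ‖⟪w i, f⟫_ℂ‖ ^ 2 ≤ B / A ^ 2 * ‖f‖ ^ 2} :=
      isClosed_le (by fun_prop) (by fun_prop)
    exact closure_minimal (fun f hf => hbw_span f hf s) hcl hf
  obtain ⟨Cv, hCv⟩ := exists_analysis_operator hbv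
  obtain ⟨Cw, hCw⟩ := exists_analysis_operator hbw
  have hinner : ∀ f h : H, HasSum (fun i => ⟪w i, f⟫_ℂ * ⟪h, v i⟫_ℂ) ⟪Cv h, Cw f⟫_ℂ := by
    intro f h
    refine (lp.hasSum_inner (Cv h) (Cw f)).congr_fun fun i => ?_
    simp [hCv, hCw]
  have hKeq : ∀ f ∈ K, ⟪Cv h, Cw f⟫_ℂ = ⟪h, f⟫_ℂ := by
    have hcl : IsClosed {f : H | ⟪Cv h, Cw f⟫_ℂ = ⟪h, f⟫_ℂ} :=
      isClosed_eq (by fun_prop) (by fun_prop)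
    refine fun f hf => closure_minimal (fun f hf => ?_) hcl hf
    obtain ⟨f', -, h1, h2⟩ := hlift f hf
    refine (hinner f h).unique ((h2.mapL (innerSL ℂ h)).congr_fun fun i => ?_)
    simp [h1]
  have hproj : ∀ i, ⟪w i, K.starProjection f⟫_ℂ = ⟪w i, f⟫_ℂ := fun i => by
    rw [← K.inner_starProjection_left_eq_right, K.starProjection_eq_self_iff.2 (hwK i)]
  have := hinner (K.starProjection f) h
  rw [hKeq _ (K.starProjection_apply_mem f)] at this
  simpa only [hproj] using this

end FrameSequences

/-- The character `t ↦ e^{2πit}`. -/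
def chr (t : ℝ) : ℂ := Complex.exp (2 * Real.pi * Complex.I * t)

lemma chr_add (s t : ℝ) : chr (s + t) = chr s * chr t := by
  simp only [chr, ← Complex.exp_add]; push_cast; ring_nf

lemma chr_zero : chr 0 = 1 := by simp [chr]

lemma chr_eq_exp_ofReal_mul_I (t : ℝ) :
    chr t = Complex.exp ((2 * Real.pi * t : ℝ) * Complex.I) := by
  simp only [chr]; push_cast; ring_nf

lemma norm_chr (t : ℝ) : ‖chr t‖ = 1 := by
  rw [chr_eq_exp_ofReal_mul_I, Complex.norm_exp_ofReal_mul_I]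

lemma conj_chr (t : ℝ) : conj (chr t) = chr (-t) := by
  simp [chr, ← Complex.exp_conj, map_ofNat]

lemma chr_intCast (n : ℤ) : chr n = 1 := by
  rw [chr, Complex.exp_eq_one_iff]; exact ⟨n, by push_cast; ring⟩

lemma chr_eq_one_iff (t : ℝ) : chr t = 1 ↔ ∃ n : ℤ, t = n := by
  refine ⟨fun h => ?_, ?_⟩
  · rw [chr, Complex.exp_eq_one_iff] at h
    obtain ⟨n, hn⟩ := h
    refine ⟨n, ?_⟩
    have hne : (2 * Real.pi * Complex.I : ℂ) ≠ 0 := Complex.two_pi_I_ne_zero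
    have : (t : ℂ) = n := mul_left_cancel₀ hne (by rw [hn]; ring)
    exact_mod_cast this
  · rintro ⟨n, rfl⟩; exact chr_intCast n

@[fun_prop]
lemma continuous_chr : Continuous chr := by unfold chr; fun_prop

/-- Parseval's identity for two functions on an interval of length `T`. -/
lemma hasSum_fourier_mul {T : ℝ} (hT : 0 < T) (a : ℝ) {F G : ℝ → ℂ}
    (hF : MemLp F 2 (volume.restrict (Set.Ioc a (a + T))))
    (hG : MemLp G 2 (volume.restrict (Set.Ioc a (a + T)))) :
    HasSum (fun m : ℤ => (∫ x in Set.Ioc a (a + T), chr (-(m * x / T)) * F x) *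
        ∫ x in Set.Ioc a (a + T), chr (m * x / T) * G x)
      (T * ∫ x in Set.Ioc a (a + T), F x * G x) := by
  have : Fact (0 < T) := ⟨hT⟩
  have hle : a ≤ a + T := by linarith
  have hTC : (T : ℂ) ≠ 0 := by exact_mod_cast hT.ne'
  have hG' : MemLp (fun x => conj (G x)) 2 (volume.restrict (Set.Ioc a (a + T))) := hG.star
  have hf := hF.memLp_liftIoc.haarAddCircle
  have hg := hG'.memLp_liftIoc.haarAddCircle
  have hcoeff : ∀ (F : ℝ → ℂ) (m : ℤ), fourierCoeff (AddCircle.liftIoc T a F) m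
      = (T : ℂ)⁻¹ * ∫ x in Set.Ioc a (a + T), chr (-(m * x / T)) * F x := by
    intro F m
    rw [fourierCoeff_liftIoc_eq, fourierCoeffOn_eq_integral, intervalIntegral.integral_of_le hle,
      Complex.real_smul]
    simp only [add_sub_cancel_left, one_div, Complex.ofReal_inv, fourier_coe_apply, smul_eq_mul]
    congr 2
    ext x
    congr 1
    simp only [chr]
    push_cast
    ring_nf
  have hcoeffG : ∀ m : ℤ, conj (fourierCoeff (AddCircle.liftIoc T a fun x => conj (G x)) m)
      = (T : ℂ)⁻¹ * ∫ x in Set.Ioc a (a + T), chr (m * x / T) * G x := by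
    intro m
    rw [hcoeff, map_mul, ← integral_conj]
    simp [conj_chr]
  have key := fourierBasis.hasSum_inner_mul_inner hg.toLp hf.toLp
  have h1 : ∀ m : ℤ, ⟪hg.toLp, fourierBasis m⟫_ℂ * ⟪fourierBasis m, hf.toLp⟫_ℂ
      = (T : ℂ)⁻¹ ^ 2 * ((∫ x in Set.Ioc a (a + T), chr (-(m * x / T)) * F x) *
        ∫ x in Set.Ioc a (a + T), chr (m * x / T) * G x) := by
    intro m
    rw [← inner_conj_symm, ← fourierBasis.repr_apply_apply, ← fourierBasis.repr_apply_apply,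
      fourierBasis_repr, fourierBasis_repr, fourierCoeff_congr_ae hg.coeFn_toLp,
      fourierCoeff_congr_ae hf.coeFn_toLp, hcoeffG, hcoeff]
    ring
  have h2 : ⟪hg.toLp, hf.toLp⟫_ℂ = (T : ℂ)⁻¹ * ∫ x in Set.Ioc a (a + T), F x * G x := by
    rw [L2.inner_def, ← intervalIntegral.integral_of_le hle,
      ← AddCircle.integral_liftIoc_eq_intervalIntegral, ← Complex.ofReal_inv, ← Complex.real_smul,
      ← AddCircle.integral_haarAddCircle]
    apply integral_congr_ae
    filter_upwards [hf.coeFn_toLp, hg.coeFn_toLp] with x hx hy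
    rw [hx, hy]
    simp [AddCircle.liftIoc]
  simp only [h1] at key
  rw [h2] at key
  have := key.mul_left ((T : ℂ) ^ 2)
  convert! this using 1
  · ext m; field_simp
  · field_simp

section TimeFrequencyShifts

lemma coeFn_Tr (a : ℝ) (f : L2) : Tr a f =ᵐ[volume] fun x => f (x - a) :=
  (memLp_translate a f).coeFn_toLp

lemma coeFn_Mo (b : ℝ) (f : L2) : Mo b f =ᵐ[volume] fun x => chr (b * x) * f x := by
  filter_upwards [(memLp_modulate b f).coeFn_toLp] with x hx
  rw [Mo, hx, chr]
  push_cast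
  rfl

lemma ae_comp_sub {p : ℝ → Prop} (h : ∀ᵐ x, p x) (a : ℝ) : ∀ᵐ x, p (x - a) :=
  (measurePreserving_sub_right volume a).quasiMeasurePreserving.ae h

lemma Tr_Tr (a b : ℝ) (f : L2) : Tr a (Tr b f) = Tr (a + b) f := by
  apply Lp.ext
  filter_upwards [coeFn_Tr a (Tr b f), coeFn_Tr (a + b) f, ae_comp_sub (coeFn_Tr b f) a]
    with x h1 h2 h3
  rw [h1, h2, h3, sub_sub]

lemma Tr_zero (f : L2) : Tr 0 f = f := by
  apply Lp.ext
  filter_upwards [coeFn_Tr 0 f] with x h1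
  rw [h1, sub_zero]

lemma Mo_Mo (a b : ℝ) (f : L2) : Mo a (Mo b f) = Mo (a + b) f := by
  apply Lp.ext
  filter_upwards [coeFn_Mo a (Mo b f), coeFn_Mo (a + b) f, coeFn_Mo b f] with x h1 h2 h3
  rw [h1, h2, h3, add_mul, chr_add, mul_assoc]

lemma Mo_zero (f : L2) : Mo 0 f = f := by
  apply Lp.ext
  filter_upwards [coeFn_Mo 0 f] with x h1
  rw [h1, zero_mul, chr_zero, one_mul]

lemma Mo_Tr (a b : ℝ) (f : L2) : Mo b (Tr a f) = chr (b * a) • Tr a (Mo b f) := by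
  apply Lp.ext
  filter_upwards [coeFn_Mo b (Tr a f), coeFn_Tr a f, coeFn_Tr a (Mo b f),
    Lp.coeFn_smul (chr (b * a)) (Tr a (Mo b f)), ae_comp_sub (coeFn_Mo b f) a] with x h1 h2 h3 h4 h5
  rw [h1, h2, h4, Pi.smul_apply, h3, h5, smul_eq_mul, ← mul_assoc, ← chr_add]
  ring_nf

/-- Translation as a unitary operator. -/
def trIso (a : ℝ) : L2 ≃ₗᵢ[ℂ] L2 where
  toFun := Tr a
  invFun := Tr (-a)
  left_inv f := by rw [Tr_Tr, neg_add_cancel, Tr_zero]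
  right_inv f := by rw [Tr_Tr, add_neg_cancel, Tr_zero]
  map_add' f h := by
    apply Lp.ext
    filter_upwards [coeFn_Tr a (f + h), coeFn_Tr a f, coeFn_Tr a h,
      Lp.coeFn_add (Tr a f) (Tr a h), ae_comp_sub (Lp.coeFn_add f h) a] with x h1 h2 h3 h4 h5
    rw [h1, h4, h5, Pi.add_apply, Pi.add_apply, h2, h3]
  map_smul' c f := by
    apply Lp.ext
    filter_upwards [coeFn_Tr a (c • f), coeFn_Tr a f, Lp.coeFn_smul c (Tr a f),
      ae_comp_sub (Lp.coeFn_smul c f) a] with x h1 h2 h3 h4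
    simp only [RingHom.id_apply]
    rw [h1, h3, h4, Pi.smul_apply, Pi.smul_apply, h2]
  norm_map' f := by
    change ‖Tr a f‖ = ‖f‖
    rw [Lp.norm_def, Lp.norm_def, eLpNorm_congr_ae (coeFn_Tr a f)]
    congr 1
    exact eLpNorm_comp_measurePreserving (Lp.aestronglyMeasurable f)
      (measurePreserving_sub_right volume a)

/-- Modulation as a unitary operator. -/
def moIso (b : ℝ) : L2 ≃ₗᵢ[ℂ] L2 where
  toFun := Mo b
  invFun := Mo (-b)
  left_inv f := by rw [Mo_Mo, neg_add_cancel, Mo_zero]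
  right_inv f := by rw [Mo_Mo, add_neg_cancel, Mo_zero]
  map_add' f h := by
    apply Lp.ext
    filter_upwards [coeFn_Mo b (f + h), coeFn_Mo b f, coeFn_Mo b h,
      Lp.coeFn_add (Mo b f) (Mo b h), Lp.coeFn_add f h] with x h1 h2 h3 h4 h5
    rw [h1, h4, h5, Pi.add_apply, Pi.add_apply, h2, h3, mul_add]
  map_smul' c f := by
    apply Lp.ext
    filter_upwards [coeFn_Mo b (c • f), coeFn_Mo b f, Lp.coeFn_smul c (Mo b f),
      Lp.coeFn_smul c f] with x h1 h2 h3 h4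
    simp only [RingHom.id_apply]
    rw [h1, h3, h4, Pi.smul_apply, Pi.smul_apply, h2, smul_eq_mul, smul_eq_mul]
    ring
  norm_map' f := by
    change ‖Mo b f‖ = ‖f‖
    rw [Lp.norm_def, Lp.norm_def]
    congr 1
    refine eLpNorm_congr_norm_ae ?_
    filter_upwards [coeFn_Mo b f] with x hx
    rw [hx, norm_mul, norm_chr, one_mul]

/-- A time-frequency shift as a unitary operator. -/
def tfIso (z : ℝ × ℝ) : L2 ≃ₗᵢ[ℂ] L2 := (moIso z.2).trans (trIso z.1)

lemma trIso_apply (a : ℝ) (f : L2) : trIso a f = Tr a f := rfl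

lemma Tr_smul (a : ℝ) (c : ℂ) (f : L2) : Tr a (c • f) = c • Tr a f := (trIso a).map_smul c f

lemma tf_smul (z : ℝ × ℝ) (c : ℂ) (f : L2) : tf z (c • f) = c • tf z f := (tfIso z).map_smul c f

lemma inner_Tr_Tr (a : ℝ) (f h : L2) : ⟪Tr a f, Tr a h⟫_ℂ = ⟪f, h⟫_ℂ :=
  (trIso a).inner_map_map f h

lemma inner_tf_tf (z : ℝ × ℝ) (f h : L2) : ⟪tf z f, tf z h⟫_ℂ = ⟪f, h⟫_ℂ :=
  (tfIso z).inner_map_map f h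

lemma tf_tf (z w : ℝ × ℝ) (f : L2) : tf z (tf w f) = chr (z.2 * w.1) • tf (z + w) f := by
  simp only [tf, Mo_Tr, Tr_smul, Mo_Mo, Tr_Tr, Prod.fst_add, Prod.snd_add]

lemma tf_add (z w : ℝ × ℝ) (f : L2) : tf (z + w) f = chr (-(z.2 * w.1)) • tf z (tf w f) := by
  rw [tf_tf, smul_smul, ← chr_add, neg_add_cancel, chr_zero, one_smul]

lemma Tr_eq_tf (a : ℝ) (f : L2) : Tr a f = tf (a, 0) f := by simp only [tf, Mo_zero]

lemma Tr_tf (s : ℝ) (z : ℝ × ℝ) (f : L2) : Tr s (tf z f) = chr (-(z.2 * s)) • tf z (Tr s f) := by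
  rw [Tr_eq_tf, Tr_eq_tf, tf_tf, tf_tf, smul_smul, ← chr_add, add_comm z]
  simp [chr_zero]

lemma coeFn_tf (a b : ℝ) (f : L2) :
    tf (a, b) f =ᵐ[volume] fun x => chr (b * (x - a)) * f (x - a) := by
  filter_upwards [coeFn_Tr a (Mo b f), ae_comp_sub (coeFn_Mo b f) a] with x h1 h2
  rw [tf, h1, h2]

end TimeFrequencyShifts

section GaborLattice

/-- The Gabor family `(g, αℤ × βℤ)`, indexed by `ℤ × ℤ`. -/
def gaborFamily (g : L2) (α β : ℝ) (p : ℤ × ℤ) : L2 := tf (α * p.1, β * p.2) g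

/-- The closed linear span of the Gabor family, as a submodule. -/
def gaborSubmodule (g : L2) (α β : ℝ) : Submodule ℂ L2 :=
  (Submodule.span ℂ (Set.range (gaborFamily g α β))).topologicalClosure

lemma sepLattice_eq_range (α β : ℝ) :
    sepLattice α β = Set.range fun p : ℤ × ℤ => ((α * p.1, β * p.2) : ℝ × ℝ) := by
  ext z; simp [sepLattice, eq_comm]

lemma mem_gaborSpan_iff (g : L2) (α β : ℝ) (f : L2) :
    f ∈ gaborSpan g (sepLattice α β) ↔ f ∈ gaborSubmodule g α β := by
  rw [gaborSpan, sepLattice_eq_range, ← Set.range_comp]; rfl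

/-- The parametrization of `αℤ × βℤ` by `ℤ × ℤ`. -/
def sepLatticeEquiv {α β : ℝ} (hα : 0 < α) (hβ : 0 < β) : ℤ × ℤ ≃ sepLattice α β :=
  Equiv.ofBijective (fun p => ⟨(α * p.1, β * p.2), p.1, p.2, rfl⟩) <| by
    constructor
    · rintro ⟨a, b⟩ ⟨c, d⟩ h
      simpa [hα.ne', hβ.ne'] using congrArg Subtype.val h
    · rintro ⟨_, k, l, rfl⟩
      exact ⟨(k, l), rfl⟩

lemma gaborFamily_add (g : L2) (α β : ℝ) (p q : ℤ × ℤ) :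
    gaborFamily g α β (p + q) =
      chr (-(β * p.2 * (α * q.1))) • tf (α * p.1, β * p.2) (gaborFamily g α β q) := by
  have h := tf_add (α * p.1, β * p.2) (α * q.1, β * q.2) g
  simpa [gaborFamily, mul_add] using h

lemma gaborFamily_mem (g : L2) (α β : ℝ) (p : ℤ × ℤ) :
    gaborFamily g α β p ∈ gaborSubmodule g α β :=
  Submodule.le_topologicalClosure _ (Submodule.subset_span ⟨p, rfl⟩)

lemma gaborSubmodule_invariant {g : L2} {α β : ℝ} (U : L2 ≃ₗᵢ[ℂ] L2)
    (hU : ∀ p, U (gaborFamily g α β p) ∈ gaborSubmodule g α β) {f : L2}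
    (hf : f ∈ gaborSubmodule g α β) : U f ∈ gaborSubmodule g α β := by
  have hcl : IsClosed {f : L2 | U f ∈ gaborSubmodule g α β} :=
    (Submodule.isClosed_topologicalClosure _).preimage U.continuous
  have hle : Submodule.span ℂ (Set.range (gaborFamily g α β)) ≤
      (gaborSubmodule g α β).comap U.toLinearEquiv.toLinearMap := by
    rw [Submodule.span_le]
    rintro _ ⟨p, rfl⟩
    exact hU p
  exact closure_minimal hle hcl hf

lemma tf_mem_gaborSubmodule {g : L2} {α β : ℝ} (p : ℤ × ℤ) {f : L2}
    (hf : f ∈ gaborSubmodule g α β) : tf (α * p.1, β * p.2) f ∈ gaborSubmodule g α β := by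
  refine gaborSubmodule_invariant (tfIso _) (fun q => ?_) hf
  have h := (gaborSubmodule g α β).smul_mem (chr (β * p.2 * (α * q.1)))
    (gaborFamily_mem g α β (p + q))
  rwa [gaborFamily_add, smul_smul, ← chr_add, add_neg_cancel, chr_zero, one_smul] at h

lemma Tr_mem_gaborSubmodule {g : L2} {α β s : ℝ} (hs : Tr s g ∈ gaborSubmodule g α β) {f : L2}
    (hf : f ∈ gaborSubmodule g α β) : Tr s f ∈ gaborSubmodule g α β := by
  refine gaborSubmodule_invariant (trIso s) (fun q => ?_) hf
  rw [trIso_apply, gaborFamily, Tr_tf]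
  exact Submodule.smul_mem _ _ (tf_mem_gaborSubmodule q hs)

lemma Tr_neg_mem_gaborSubmodule {g : L2} {α β : ℝ} {ν : ℕ} (hν : 1 ≤ ν)
    (hs : Tr (α / ν) g ∈ gaborSubmodule g α β) {f : L2}
    (hf : f ∈ gaborSubmodule g α β) : Tr (-(α / ν)) f ∈ gaborSubmodule g α β := by
  have hpow : ∀ n : ℕ, Tr (n * (α / ν)) f ∈ gaborSubmodule g α β := by
    intro n
    induction n with
    | zero => simpa [Tr_zero] using hf
    | succ n ih =>
      have h := Tr_mem_gaborSubmodule hs ih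
      rw [Tr_Tr] at h
      convert! h using 2
      push_cast
      ring
  have h := tf_mem_gaborSubmodule (-1, 0) (hpow (ν - 1))
  have hν' : (ν : ℝ) ≠ 0 := by positivity
  have e : (α * ((-1 : ℤ) : ℝ), β * ((0 : ℤ) : ℝ)) = (-α, 0) := by simp
  simp only [e] at h
  rw [← Tr_eq_tf, Tr_Tr] at h
  convert! h using 2
  push_cast [Nat.cast_sub hν]
  field_simp
  ring

lemma inner_Tr_starProjection_Tr {g : L2} {α β : ℝ} {ν : ℕ} (hν : 1 ≤ ν)
    (hs : Tr (α / ν) g ∈ gaborSubmodule g α β) [(gaborSubmodule g α β).HasOrthogonalProjection]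
    (f h : L2) :
    ⟪Tr (α / ν) h, (gaborSubmodule g α β).starProjection (Tr (α / ν) f)⟫_ℂ =
      ⟪h, (gaborSubmodule g α β).starProjection f⟫_ℂ := by
  set K := gaborSubmodule g α β
  have hcomm : K.starProjection (Tr (α / ν) f) = Tr (α / ν) (K.starProjection f) := by
    refine (K.eq_starProjection_of_mem_of_inner_eq_zero
      (Tr_mem_gaborSubmodule hs (K.starProjection_apply_mem f)) fun w hw => ?_)
    have hw' := Tr_neg_mem_gaborSubmodule hν hs hw
    rw [← inner_Tr_Tr (-(α / ν)), ← trIso_apply, ← trIso_apply (a := α / ν),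
      ← trIso_apply (a := α / ν), ← map_sub, trIso_apply, trIso_apply, Tr_Tr, neg_add_cancel,
      Tr_zero]
    exact K.starProjection_inner_eq_zero f _ hw'
  rw [hcomm, inner_Tr_Tr]

lemma hasSum_gaborFamily_dual {g γ : L2} {α β : ℝ} (hα : 0 < α) (hβ : 0 < β)
    (hγ : IsDualWindow g γ α β) (q : ℤ × ℤ) :
    HasSum (fun p => ⟪gaborFamily g α β p, gaborFamily γ α β q⟫_ℂ • gaborFamily g α β p)
      (gaborFamily g α β q) := by
  have h := (sepLatticeEquiv hα hβ).hasSum_iff.2 hγ.2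
  have h' := h.mapL (tfIso (α * q.1, β * q.2)).toContinuousLinearEquiv.toContinuousLinearMap
  rw [← (Equiv.addLeft q).hasSum_iff]
  refine h'.congr_fun fun p => ?_
  change ⟪gaborFamily g α β (q + p), tf (α * q.1, β * q.2) γ⟫_ℂ • gaborFamily g α β (q + p) =
    tf (α * q.1, β * q.2) (⟪gaborFamily g α β p, γ⟫_ℂ • gaborFamily g α β p)
  rw [gaborFamily_add, tf_smul, inner_smul_left, inner_tf_tf, smul_smul, conj_chr, mul_right_comm,
    ← chr_add]
  simp [chr_zero]

/-- The orthogonal projection onto the closed span of a Gabor frame sequence, in terms of the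
canonical dual window. -/
lemma hasSum_gabor_inner_starProjection {g γ : L2} {α β : ℝ} (hα : 0 < α) (hβ : 0 < β)
    (hframe : IsFrameSeq g (sepLattice α β)) (hγ : IsDualWindow g γ α β)
    [(gaborSubmodule g α β).HasOrthogonalProjection] (f h : L2) :
    HasSum (fun p => ⟪gaborFamily γ α β p, f⟫_ℂ * ⟪h, gaborFamily g α β p⟫_ℂ)
      ⟪h, (gaborSubmodule g α β).starProjection f⟫_ℂ := by
  obtain ⟨A, B, hA, hB, hAB⟩ := hframe
  have hre : ∀ f : L2, ∑' p, ‖⟪gaborFamily g α β p, f⟫_ℂ‖ ^ 2 =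
      ∑' lam : sepLattice α β, ‖⟪tf (lam : ℝ × ℝ) g, f⟫_ℂ‖ ^ 2 := fun f =>
    (sepLatticeEquiv hα hβ).tsum_eq fun lam : sepLattice α β =>
      ‖⟪tf (lam : ℝ × ℝ) g, f⟫_ℂ‖ ^ 2
  refine hasSum_inner_starProjection hA hB (fun f hf => ?_) (fun f hf => ?_)
    (fun p => tf_mem_gaborSubmodule p ((mem_gaborSpan_iff g α β γ).1 hγ.1))
    (hasSum_gaborFamily_dual hα hβ hγ) f h
  · rw [hre]; exact (hAB f ((mem_gaborSpan_iff g α β f).2 hf)).1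
  · rw [hre]; exact (hAB f ((mem_gaborSpan_iff g α β f).2 hf)).2

end GaborLattice

section Boxes

lemma memLp_chr_mul {μ : Measure ℝ} {F : ℝ → ℂ} (hF : MemLp F 2 μ) (c : ℝ) :
    MemLp (fun x => chr (c * x) * F x) 2 μ := by
  refine hF.of_le ?_ (Eventually.of_forall fun x => ?_)
  · exact (by fun_prop : Continuous fun x : ℝ => chr (c * x)).aestronglyMeasurable.mul hF.1
  · rw [norm_mul, norm_chr, one_mul]

lemma memLp_box (c s t : ℝ) :
    MemLp ((Set.Ioc s t).indicator fun x => chr (c * x)) 2 (volume : Measure ℝ) := by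
  have h1 : MemLp (fun _ : ℝ => (1 : ℂ)) 2 (volume.restrict (Set.Ioc s t)) := memLp_const 1
  rw [memLp_indicator_iff_restrict measurableSet_Ioc]
  simpa using memLp_chr_mul h1 c

/-- The modulated box `1_{(s,t]}(x) e^{2πicx}`. -/
def box (c s t : ℝ) : L2 := (memLp_box c s t).toLp _

lemma coeFn_box (c s t : ℝ) :
    box c s t =ᵐ[volume] (Set.Ioc s t).indicator fun x => chr (c * x) :=
  (memLp_box c s t).coeFn_toLp

lemma Tr_box (a c s t : ℝ) : Tr a (box c s t) = chr (-(c * a)) • box c (s + a) (t + a) := by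
  apply Lp.ext
  filter_upwards [coeFn_Tr a (box c s t), ae_comp_sub (coeFn_box c s t) a,
    coeFn_box c (s + a) (t + a), Lp.coeFn_smul (chr (-(c * a))) (box c (s + a) (t + a))]
    with x h1 h2 h3 h4
  rw [h1, h2, h4, Pi.smul_apply, h3]
  have hiff : x - a ∈ Set.Ioc s t ↔ x ∈ Set.Ioc (s + a) (t + a) := by
    simp [lt_sub_iff_add_lt]
  by_cases hx : x ∈ Set.Ioc (s + a) (t + a)
  · rw [Set.indicator_of_mem hx, Set.indicator_of_mem (hiff.2 hx), smul_eq_mul, ← chr_add]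
    ring_nf
  · rw [Set.indicator_of_notMem hx, Set.indicator_of_notMem (fun h => hx (hiff.1 h)), smul_zero]

lemma inner_tf_box (γ : L2) (a b c s t : ℝ) :
    ⟪tf (a, b) γ, box c s t⟫_ℂ =
      chr (b * a) * ∫ x in Set.Ioc s t, chr (-(b * x)) * (chr (c * x) * conj (γ (x - a))) := by
  rw [L2.inner_def, ← integral_indicator measurableSet_Ioc, ← integral_const_mul]
  apply integral_congr_ae
  filter_upwards [coeFn_tf a b γ, coeFn_box c s t] with x h1 h2
  rw [h1, h2]
  by_cases hx : x ∈ Set.Ioc s t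
  · have e : chr (-(b * (x - a))) = chr (b * a) * chr (-(b * x)) := by
      rw [← chr_add]; ring_nf
    simp only [Set.indicator_of_mem hx, RCLike.inner_apply, map_mul, conj_chr, e]
    ring
  · simp [Set.indicator_of_notMem hx]

lemma inner_box_tf (g : L2) (a b s t : ℝ) :
    ⟪box 0 s t, tf (a, b) g⟫_ℂ =
      chr (-(b * a)) * ∫ x in Set.Ioc s t, chr (b * x) * g (x - a) := by
  rw [L2.inner_def, ← integral_indicator measurableSet_Ioc, ← integral_const_mul]
  apply integral_congr_ae
  filter_upwards [coeFn_tf a b g, coeFn_box 0 s t] with x h1 h2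
  rw [h1, h2]
  by_cases hx : x ∈ Set.Ioc s t
  · have e : chr (b * (x - a)) = chr (-(b * a)) * chr (b * x) := by
      rw [← chr_add]; ring_nf
    simp only [Set.indicator_of_mem hx, RCLike.inner_apply, e, zero_mul, chr_zero, map_one]
    ring
  · simp [Set.indicator_of_notMem hx]

/-- Parseval's identity on an interval of length at most `T`. -/
lemma hasSum_fourier_mul_of_le {T : ℝ} (hT : 0 < T) {s t : ℝ} (hst : t ≤ s + T) {F G : ℝ → ℂ}
    (hF : MemLp F 2) (hG : MemLp G 2) :
    HasSum (fun m : ℤ => (∫ x in Set.Ioc s t, chr (-(m * x / T)) * F x) *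
        ∫ x in Set.Ioc s t, chr (m * x / T) * G x)
      (T * ∫ x in Set.Ioc s t, F x * G x) := by
  have hsub : Set.Ioc s (s + T) ∩ Set.Ioc s t = Set.Ioc s t :=
    Set.inter_eq_right.2 (Set.Ioc_subset_Ioc_right hst)
  have key := hasSum_fourier_mul hT s
    ((hF.indicator (measurableSet_Ioc (a := s) (b := t))).restrict _)
    ((hG.indicator (measurableSet_Ioc (a := s) (b := t))).restrict _)
  have e1 : ∀ u F : ℝ → ℂ, ∫ x in Set.Ioc s (s + T), u x * (Set.Ioc s t).indicator F x =
      ∫ x in Set.Ioc s t, u x * F x := by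
    intro u F
    simp only [← Set.indicator_mul_right]
    rw [setIntegral_indicator measurableSet_Ioc, hsub]
  have e2 : ∫ x in Set.Ioc s (s + T), (Set.Ioc s t).indicator F x * (Set.Ioc s t).indicator G x =
      ∫ x in Set.Ioc s t, F x * G x := by
    simp only [← Set.indicator_mul]
    rw [setIntegral_indicator measurableSet_Ioc, hsub]
  rw [e2] at key
  refine key.congr_fun fun m => ?_
  rw [e1 (fun x => chr (-(m * x / T))), e1 (fun x => chr (m * x / T))]

/-- The correlation `conj γ(x) g(x+u) e^{2πicx}`. -/
def corr (g γ : L2) (c u x : ℝ) : ℂ := chr (c * x) * conj (γ x) * g (x + u)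

lemma integrable_corr (g γ : L2) (c u : ℝ) : Integrable (corr g γ c u) := by
  have h1 := memLp_chr_mul (Lp.memLp γ).star c
  have h2 : MemLp (fun x => g (x + u)) 2 (volume : Measure ℝ) := by
    simpa using memLp_translate (-u) g
  exact h1.integrable_mul h2

lemma inner_tf_eq_conj_integral_corr (g γ : L2) (u b : ℝ) :
    ⟪g, tf (u, b) γ⟫_ℂ = conj (∫ x, corr g γ (-b) u x) := by
  rw [← inner_conj_symm, L2.inner_def, ← integral_sub_right_eq_self (corr g γ (-b) u) u]
  congr 1
  apply integral_congr_ae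
  filter_upwards [coeFn_tf u b γ] with x hx
  rw [hx]
  simp only [corr, RCLike.inner_apply, map_mul, conj_chr, sub_add_cancel, neg_mul]
  ring

/-- The matrix coefficient of the orthogonal projection onto the Gabor space between two boxes
separated by `k / β` is a periodization of the correlation. -/
lemma hasSum_integral_corr {g γ : L2} {α β : ℝ} (hα : 0 < α) (hβ : 0 < β)
    (hframe : IsFrameSeq g (sepLattice α β)) (hγ : IsDualWindow g γ α β)
    [(gaborSubmodule g α β).HasOrthogonalProjection] (k : ℤ) {c s t : ℝ}
    (hc : ∀ n : ℤ, chr (c * (α * n)) = 1) (hst : t ≤ s + β⁻¹) :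
    HasSum (fun n : ℤ => ((β⁻¹ : ℝ) : ℂ) *
        ∫ x in Set.Ioc (s - α * n) (t - α * n), corr g γ c (k / β) x)
      ⟪Tr (k / β) (box 0 s t), (gaborSubmodule g α β).starProjection (box c s t)⟫_ℂ := by
  refine (hasSum_gabor_inner_starProjection hα hβ hframe hγ _ _).prod_fiberwise fun n => ?_
  have hF : MemLp (fun x => chr (c * x) * conj (γ (x - α * n))) 2 (volume : Measure ℝ) :=
    memLp_chr_mul (memLp_translate (α * n) γ).star c
  have hG : MemLp (fun x => g (x - (α * n - k / β))) 2 (volume : Measure ℝ) := memLp_translate _ g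
  have key := hasSum_fourier_mul_of_le (inv_pos.2 hβ) hst hF hG
  have hint : ∫ x in Set.Ioc s t, chr (c * x) * conj (γ (x - α * n)) * g (x - (α * n - k / β)) =
      ∫ x in Set.Ioc (s - α * n) (t - α * n), corr g γ c (k / β) x := by
    rw [← integral_indicator measurableSet_Ioc, ← integral_indicator measurableSet_Ioc,
      ← integral_sub_right_eq_self ((Set.Ioc (s - α * n) (t - α * n)).indicator _) (α * n)]
    congr 1
    ext x
    have hiff : x - α * n ∈ Set.Ioc (s - α * n) (t - α * n) ↔ x ∈ Set.Ioc s t := by simp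
    by_cases hx : x ∈ Set.Ioc s t
    · rw [Set.indicator_of_mem hx, Set.indicator_of_mem (hiff.2 hx), corr]
      have e : chr (c * x) = chr (c * (x - α * n)) := by
        rw [← mul_one (chr (c * (x - α * n))), ← hc n, ← chr_add]; ring_nf
      rw [e]
      ring_nf
    · rw [Set.indicator_of_notMem hx, Set.indicator_of_notMem (fun h => hx (hiff.1 h))]
  rw [hint] at key
  refine key.congr_fun fun m => ?_
  have hshift : ⟪Tr (k / β) (box 0 s t), gaborFamily g α β (n, m)⟫_ℂ =
      ⟪box 0 s t, tf (α * n - k / β, β * m) g⟫_ℂ := by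
    rw [← inner_Tr_Tr (-(k / β)) (Tr (k / β) (box 0 s t)), Tr_Tr, neg_add_cancel, Tr_zero,
      gaborFamily, tf, tf, Tr_Tr]
    ring_nf
  have hphase : chr (-(β * m * (α * n - k / β))) = chr (-(β * m * (α * n))) := by
    have e : -(β * m * (α * n - k / β)) = -(β * m * (α * n)) + ((m * k : ℤ) : ℝ) := by
      push_cast; field_simp; ring
    rw [e, chr_add, chr_intCast, mul_one]
  have hm : ∀ x : ℝ, (m : ℝ) * x / β⁻¹ = β * m * x := fun x => by field_simp
  have hone : chr (β * m * (α * n)) * chr (-(β * m * (α * n))) = 1 := by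
    rw [← chr_add, add_neg_cancel, chr_zero]
  simp only [hm]
  rw [hshift, inner_box_tf, gaborFamily, inner_tf_box, hphase, mul_mul_mul_comm, hone, one_mul]

end Boxes

section Periodicity

/-- If the sums of `b` over residue classes modulo `M` pick up a factor `ω` under the shift by `N`,
then so does the total sum. -/
lemma sum_eq_mul_of_residue_sums_shift {b : ℤ → ℂ} {S ω : ℂ} {M : ℕ} [NeZero M] (N : ℤ)
    (hb : HasSum b S) {a : ℤ → ℂ} (ha : ∀ j, HasSum (fun n : ℤ => b (j - n * M)) (a j))
    (hshift : ∀ j, a (j + N) = ω * a j) : S = ω * S := by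
  have hsum : ∀ (b : ℤ → ℂ) (a : ℤ → ℂ), HasSum b S →
      (∀ j, HasSum (fun n : ℤ => b (j - n * M)) (a j)) → ∑ r : Fin M, a (r : ℕ) = S := by
    intro b a hb ha
    have h1 := ((Equiv.prodComm _ _).trans (Int.divModEquiv M).symm).hasSum_iff.2 hb
    have h2 : HasSum (fun r : Fin M => a (r : ℕ)) S := h1.prod_fiberwise fun r => by
      rw [← (Equiv.neg ℤ).hasSum_iff]
      refine (ha (r : ℕ)).congr_fun fun n => ?_
      simp only [Function.comp_apply, Equiv.trans_apply, Equiv.prodComm_apply, Prod.swap_prod_mk,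
        Int.divModEquiv_symm_apply, Equiv.neg_apply]
      ring_nf
    exact (hasSum_fintype _).unique h2
  have h1 := hsum b a hb ha
  have h2 := hsum (fun j => b (j + N)) (fun j => a (j + N))
    ((Equiv.addRight N).hasSum_iff.2 hb) fun j => by
      refine (ha (j + N)).congr_fun fun n => ?_
      ring_nf
  simp only [hshift, ← Finset.mul_sum] at h2
  rw [h1] at h2
  exact h2.symm

lemma integral_corr_eq_zero {g γ : L2} {α β : ℝ} (hα : 0 < α) (hβ : 0 < β)
    (hframe : IsFrameSeq g (sepLattice α β)) (hγ : IsDualWindow g γ α β) {ν : ℕ} (hν : 1 ≤ ν)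
    (hs : Tr (α / ν) g ∈ gaborSubmodule g α β) (k : ℤ) {c : ℝ}
    (hc : ∀ n : ℤ, chr (c * (α * n)) = 1) (hne : chr (c * (α / ν)) ≠ 1) :
    ∫ x, corr g γ c (k / β) x = 0 := by
  have : CompleteSpace (gaborSubmodule g α β) :=
    (Submodule.isClosed_topologicalClosure _).completeSpace_coe
  have hν0 : (0 : ℝ) < ν := by exact_mod_cast hν
  obtain ⟨N, hN⟩ := exists_nat_gt (α / ν * β)
  have hN0 : (0 : ℝ) < N := lt_trans (by positivity) hN
  have hM : ν * N ≠ 0 := by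
    have : N ≠ 0 := by rintro rfl; simp at hN0
    positivity
  have : NeZero (ν * N) := ⟨hM⟩
  set ε : ℝ := α / ν / N with hε
  have hε0 : 0 < ε := by positivity
  have hεN : N * ε = α / ν := by rw [hε]; field_simp
  have hεM : (ν * N : ℝ) * ε = α := by rw [hε]; field_simp
  have hεβ : ε ≤ β⁻¹ := by
    rw [hε, div_le_iff₀ hN0, ← div_eq_inv_mul, le_div_iff₀ hβ]
    exact hN.le
  let b : ℤ → ℂ := fun j => ∫ x in Set.Ioc (j • ε) ((j + 1) • ε), corr g γ c (k / β) x
  have hb : HasSum b (∫ x, corr g γ c (k / β) x) := by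
    have h := hasSum_integral_iUnion (μ := volume) (f := corr g γ c (k / β))
      (s := fun j : ℤ => Set.Ioc (j • ε) ((j + 1) • ε)) (fun _ => measurableSet_Ioc)
      (Set.pairwise_disjoint_Ioc_zsmul ε) (integrable_corr g γ c _).integrableOn
    rwa [iUnion_Ioc_zsmul hε0, setIntegral_univ] at h
  let P := (gaborSubmodule g α β).starProjection
  let a : ℤ → ℂ := fun j => β * ⟪Tr (k / β) (box 0 (j * ε) ((j + 1) * ε)),
    P (box c (j * ε) ((j + 1) * ε))⟫_ℂ
  have hβC : (β : ℂ) ≠ 0 := by exact_mod_cast hβ.ne'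
  have ha : ∀ j, HasSum (fun n : ℤ => b (j - n * (ν * N : ℕ))) (a j) := by
    intro j
    have h := (hasSum_integral_corr hα hβ hframe hγ k (s := j * ε) (t := (j + 1) * ε) hc
      (by linarith)).mul_left (β : ℂ)
    refine h.congr_fun fun n => ?_
    have e1 : (j - n * (ν * N : ℕ) : ℤ) • ε = j * ε - α * n := by
      rw [← hεM, zsmul_eq_mul]; push_cast; ring
    have e2 : (j - n * (ν * N : ℕ) + 1 : ℤ) • ε = (j + 1) * ε - α * n := by
      rw [← hεM, zsmul_eq_mul]; push_cast; ring
    simp only [b]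
    rw [e1, e2, ← mul_assoc, Complex.ofReal_inv, mul_inv_cancel₀ hβC, one_mul]
  have hshift : ∀ j, a (j + N) = chr (c * (α / ν)) * a j := by
    intro j
    have hP := inner_Tr_starProjection_Tr hν hs (box c (j * ε) ((j + 1) * ε))
      (Tr (k / β) (box 0 (j * ε) ((j + 1) * ε)))
    have e1 : ((j + N : ℤ) : ℝ) * ε = j * ε + α / ν := by rw [← hεN]; push_cast; ring
    have e2 : (((j + N : ℤ) : ℝ) + 1) * ε = (j + 1) * ε + α / ν := by
      rw [← hεN]; push_cast; ring
    rw [Tr_Tr, add_comm (α / ν), ← Tr_Tr, Tr_box (α / ν) c, Tr_box (α / ν) 0, map_smul,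
      inner_smul_right, zero_mul, neg_zero, chr_zero, one_smul] at hP
    simp only [a, P]
    rw [e1, e2, ← hP, mul_left_comm, ← mul_assoc (chr _), ← chr_add, add_neg_cancel, chr_zero,
      one_mul]
  have hfin := sum_eq_mul_of_residue_sums_shift (N : ℤ) hb ha hshift
  have : (1 - chr (c * (α / ν))) * ∫ x, corr g γ c (k / β) x = 0 := by
    rw [sub_mul, one_mul, sub_eq_zero]; exact hfin
  exact (mul_eq_zero.1 this).resolve_left (sub_ne_zero.2 hne.symm)

end Periodicity

/-- (i) ⇒ (iv) of Theorem 4.4: if `T_{α/ν} g ∈ 𝒢`, then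
`⟨T_{k/β} M_{ℓ/α} γ, g⟩ = 0` for all `k ∈ ℤ`, `ℓ ∈ ℤ \ νℤ`. -/
theorem statement_14 (g : L2) (hg : InS0 g) (α β : ℝ) (hα : 0 < α) (hβ : 0 < β)
    (hframe : IsFrameSeq g (sepLattice α β)) (γ : L2) (hγ : IsDualWindow g γ α β)
    (ν : ℕ) (hν : 1 ≤ ν)
    (hshift : Tr (α / ν) g ∈ gaborSpan g (sepLattice α β)) :
    ∀ k l : ℤ, ¬ ((ν : ℤ) ∣ l) →
      ⟪g, tf ((k : ℝ) / β, (l : ℝ) / α) γ⟫_ℂ = 0 := by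
  intro k l hl
  have hν0 : (ν : ℝ) ≠ 0 := by positivity
  rw [inner_tf_eq_conj_integral_corr, integral_corr_eq_zero hα hβ hframe hγ hν
    ((mem_gaborSpan_iff g α β _).1 hshift) k (fun n => ?_) fun h => hl ?_, map_zero]
  · rw [chr_eq_one_iff]
    refine ⟨-(l * n), ?_⟩
    push_cast
    field_simp
  · obtain ⟨n, hn⟩ := (chr_eq_one_iff _).1 h
    refine ⟨-n, ?_⟩
    field_simp at hn
    have : (l : ℝ) = ν * -n := by linarith
    exact_mod_cast this

end
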